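/- Every harmonic homogeneous polynomial p of degree 4 on ℝ² is a harmonic square: there exists a traceless symmetric real 2×2 matrix h such that for all x ∈ ℝ², p(x) = (xᵀh x)² − (1/4)tr(h²)(x₁² + x₂²)². -/

import Mathlib

open MvPolynomial Matrix

/-- The Laplacian of a polynomial in two variables. -/
noncomputable def lap2 (p : MvPolynomial (Fin 2) ℝ) : MvPolynomial (Fin 2) ℝ :=
  ∑ i : Fin 2, pderiv i (pderiv i p)

/-- A binary form of degree `n` is a combination of the monomials `X 0 ^ i * X 1 ^ j`
with `i + j = n`. -/
lemma MvPolynomial.IsHomogeneous.exists_eq_sum_antidiagonal {R : Type*} [CommSemiring R]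
    {p : MvPolynomial (Fin 2) R} {n : ℕ} (hp : p.IsHomogeneous n) :
    ∃ c : ℕ × ℕ → R,
      p = ∑ ij ∈ Finset.HasAntidiagonal.antidiagonal n, C (c ij) * X 0 ^ ij.1 * X 1 ^ ij.2 := by
  let e : ℕ × ℕ → Fin 2 →₀ ℕ := fun ij => Finsupp.single 0 ij.1 + Finsupp.single 1 ij.2
  have he (d : Fin 2 →₀ ℕ) : e (d 0, d 1) = d := by
    ext i; fin_cases i <;> simp [e]
  have hterm (ij : ℕ × ℕ) (r : R) : C r * X 0 ^ ij.1 * X 1 ^ ij.2 = monomial (e ij) r := by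
    simp [e, X_pow_eq_monomial, C_mul_monomial, monomial_mul]
  refine ⟨fun ij => coeff (e ij) p, ?_⟩
  simp only [hterm]
  ext d
  rw [coeff_sum]
  simp only [coeff_monomial]
  rw [Finset.sum_eq_single (d 0, d 1)]
  · simp [he]
  · rintro ⟨i, j⟩ - hij
    refine if_neg fun h => hij ?_
    simp [← h, e]
  · intro hd
    rw [if_pos (he d), he d]
    refine hp.coeff_eq_zero fun h => hd ?_
    simpa [Finsupp.degree_eq_sum, Fin.sum_univ_two] using h

/-- Every complex number has a square root, in real coordinates. -/
lemma exists_sq_sub_sq_eq_and_two_mul_mul_eq (a b : ℝ) :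
    ∃ u v : ℝ, u ^ 2 - v ^ 2 = a ∧ 2 * u * v = b := by
  obtain ⟨z, hz⟩ := IsAlgClosed.exists_pow_nat_eq (⟨a, b⟩ : ℂ) (n := 2) two_pos
  have hre := congrArg Complex.re hz
  have him := congrArg Complex.im hz
  simp only [sq, Complex.mul_re, Complex.mul_im] at hre him
  exact ⟨z.re, z.im, by linarith, by linarith⟩

/-- **Verchery's factorization.** Every harmonic homogeneous polynomial of degree 4 on ℝ²
is a harmonic square: `p(x) = (xᵀhx)² − (1/4)tr(h²)(x₁²+x₂²)²` for some traceless
symmetric 2×2 matrix `h`. -/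
theorem harmonic_square_factorization_2D (p : MvPolynomial (Fin 2) ℝ)
    (hp : p.IsHomogeneous 4) (hharm : lap2 p = 0) :
    ∃ h : Matrix (Fin 2) (Fin 2) ℝ,
      h.IsSymm ∧ h.trace = 0 ∧
      ∀ x : Fin 2 → ℝ,
        eval x p = (x ⬝ᵥ h.mulVec x) ^ 2
          - 1 / 4 * (h * h).trace * (x 0 ^ 2 + x 1 ^ 2) ^ 2 := by
  obtain ⟨c, rfl⟩ := hp.exists_eq_sum_antidiagonal
  have hnum (i : Fin 2) (n : ℕ) [n.AtLeastTwo] :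
      pderiv i (OfNat.ofNat n : MvPolynomial (Fin 2) ℝ) = 0 :=
    (pderiv i).map_natCast n
  have hlap (x y : ℝ) := congrArg (eval ![x, y]) hharm
  simp [lap2, Finset.Nat.antidiagonal_succ, Fin.sum_univ_two, pderiv_X, Derivation.leibniz_pow,
    Pi.single_apply, hnum] at hlap
  have h₁ := hlap 1 0
  have h₂ := hlap 0 1
  have h₃ := hlap 1 1
  norm_num at h₁ h₂ h₃
  obtain ⟨u, v, hu, hv⟩ := exists_sq_sub_sq_eq_and_two_mul_mul_eq (2 * c (4, 0)) (c (3, 1) / 2)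
  refine ⟨!![u, v; v, -u], ?_, ?_, fun x => ?_⟩
  · ext i j; fin_cases i <;> fin_cases j <;> rfl
  · simp [trace_fin_two]
  · have e₀ : c (4, 0) = (u ^ 2 - v ^ 2) / 2 := by linarith
    have e₁ : c (3, 1) = 4 * u * v := by linarith
    have e₂ : c (2, 2) = -6 * c (4, 0) := by linarith
    have e₃ : c (1, 3) = -c (3, 1) := by linarith
    have e₄ : c (0, 4) = c (4, 0) := by linarith
    simp only [mulVec, dotProduct, Fin.sum_univ_two]
    simp [Finset.Nat.antidiagonal_succ, trace_fin_two, e₂, e₃, e₄]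
    rw [e₀, e₁]
    ring
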